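/- arXiv:2110.04339 — 5 statements merged into one kernel-verified Lean document; each statement's English description precedes it below -/
import Mathlib

section
/- Let a = -7/30, b = 7/15, c = -2/5, d = 1/2, and define η(x,t) = (3/8)·sech²((1/2)·√(5/7)·(x − 20 − (5√2/6)t)) and u(x,t) = (1/(2√2))·sech²((1/2)·√(5/7)·(x − 20 − (5√2/6)t)). Then η and u are smooth on ℝ² and satisfy, at every point (x,t) ∈ ℝ², both equations of the abcd Boussinesq system: ∂ₜη + ∂ₓu + ∂ₓ(ηu) + a·∂ₓ³u − b·∂ₓ²∂ₜη = 0 and ∂ₜu + ∂ₓη + ∂ₓ(u²/2) + c·∂ₓ³η − d·∂ₓ²∂ₜu = 0. -/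
/-- The square of the hyperbolic secant. -/
noncomputable def sechSq (z : ℝ) : ℝ := (1 / Real.cosh z) ^ 2

/-- The derivative of `sechSq`. -/
noncomputable def sechSqDeriv (z : ℝ) : ℝ := -2 * Real.sinh z / Real.cosh z ^ 3

lemma contDiff_sechSq {n : WithTop ℕ∞} : ContDiff ℝ n sechSq :=
  (contDiff_const.div Real.contDiff_cosh fun z => (Real.cosh_pos z).ne').pow 2

lemma hasDerivAt_sechSq (z : ℝ) : HasDerivAt sechSq (sechSqDeriv z) z := by
  have hc := (Real.cosh_pos z).ne'
  refine (((hasDerivAt_const z (1 : ℝ)).div (Real.hasDerivAt_cosh z) hc).pow 2).congr_deriv ?_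
  simp only [sechSqDeriv, Pi.div_apply]
  norm_num
  field_simp

lemma hasDerivAt_sechSqDeriv (z : ℝ) :
    HasDerivAt sechSqDeriv (4 * sechSq z - 6 * sechSq z ^ 2) z := by
  have hc := (Real.cosh_pos z).ne'
  refine (((Real.hasDerivAt_sinh z).const_mul (-2)).div ((Real.hasDerivAt_cosh z).pow 3)
    (pow_ne_zero 3 hc)).congr_deriv ?_
  simp only [sechSq, Pi.pow_apply]
  field_simp
  linear_combination -6 * Real.cosh z ^ 2 * Real.cosh_sq z

lemma hasDerivAt_comp_wave {f : ℝ → ℝ} {f' k r y : ℝ} (C : ℝ)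
    (hf : HasDerivAt f f' (k * (y - 20 - r))) :
    HasDerivAt (fun y => C * f (k * (y - 20 - r))) (C * k * f') y := by
  have h : HasDerivAt (fun y : ℝ => k * (y - 20 - r)) k y := by
    simpa using (((hasDerivAt_id y).sub_const 20).sub_const r).const_mul k
  exact ((hf.comp y h).const_mul C).congr_deriv (by ring)

lemma deriv_sechSq_wave (C k r : ℝ) :
    deriv (fun y => C * sechSq (k * (y - 20 - r))) =
      fun y => C * k * sechSqDeriv (k * (y - 20 - r)) :=
  funext fun _ => (hasDerivAt_comp_wave C (hasDerivAt_sechSq _)).deriv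

lemma iteratedDeriv_two_sechSqDeriv_wave (C k r y : ℝ) :
    iteratedDeriv 2 (fun y => C * sechSqDeriv (k * (y - 20 - r))) y =
      C * k ^ 2 * ((4 - 12 * sechSq (k * (y - 20 - r))) * sechSqDeriv (k * (y - 20 - r))) := by
  have h1 : deriv (fun y => C * sechSqDeriv (k * (y - 20 - r))) =
      fun y => C * k * (4 * sechSq (k * (y - 20 - r)) - 6 * sechSq (k * (y - 20 - r)) ^ 2) :=
    funext fun _ => (hasDerivAt_comp_wave C (hasDerivAt_sechSqDeriv _)).deriv
  have h2 (z : ℝ) : HasDerivAt (fun z => 4 * sechSq z - 6 * sechSq z ^ 2)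
      ((4 - 12 * sechSq z) * sechSqDeriv z) z :=
    (((hasDerivAt_sechSq z).const_mul 4).sub
      (((hasDerivAt_sechSq z).pow 2).const_mul 6)).congr_deriv (by norm_num; ring)
  rw [iteratedDeriv_succ, iteratedDeriv_one, h1,
    (hasDerivAt_comp_wave (C * k) (h2 _)).deriv]
  ring

lemma iteratedDeriv_three_sechSq_wave (C k r y : ℝ) :
    iteratedDeriv 3 (fun y => C * sechSq (k * (y - 20 - r))) y =
      C * k ^ 3 * ((4 - 12 * sechSq (k * (y - 20 - r))) * sechSqDeriv (k * (y - 20 - r))) := by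
  rw [iteratedDeriv_succ', deriv_sechSq_wave, iteratedDeriv_two_sechSqDeriv_wave]
  ring

lemma deriv_mul_sechSq_wave (C k r y : ℝ) :
    deriv (fun y => C * sechSq (k * (y - 20 - r)) ^ 2) y =
      C * k * (2 * sechSq (k * (y - 20 - r)) * sechSqDeriv (k * (y - 20 - r))) :=
  (hasDerivAt_comp_wave C (((hasDerivAt_sechSq _).pow 2).congr_deriv (by norm_num))).deriv

lemma deriv_time_sechSq_wave (C k w y s : ℝ) :
    deriv (fun s => C * sechSq (k * (y - 20 - w * s))) s =
      -(C * k * w) * sechSqDeriv (k * (y - 20 - w * s)) := by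
  have h : HasDerivAt (fun s : ℝ => k * (y - 20 - w * s)) (-(k * w)) s := by
    simpa using (((hasDerivAt_id s).const_mul w).const_sub (y - 20)).const_mul k
  exact ((((hasDerivAt_sechSq _).comp s h).const_mul C).congr_deriv (by ring)).deriv


/-- The traveling-wave pair (η, u) is smooth and solves the abcd
Boussinesq system with a = -7/30, b = 7/15, c = -2/5, d = 1/2. -/
theorem abcd_boussinesq_traveling_wave_case1
    (η u : ℝ → ℝ → ℝ)
    (hη : ∀ x t : ℝ, η x t =
      3 / 8 * (1 / Real.cosh (1 / 2 * Real.sqrt (5 / 7) *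
        (x - 20 - 5 * Real.sqrt 2 / 6 * t))) ^ 2)
    (hu : ∀ x t : ℝ, u x t =
      1 / (2 * Real.sqrt 2) * (1 / Real.cosh (1 / 2 * Real.sqrt (5 / 7) *
        (x - 20 - 5 * Real.sqrt 2 / 6 * t))) ^ 2) :
    ContDiff ℝ (⊤ : ℕ∞) (fun p : ℝ × ℝ => η p.1 p.2) ∧
    ContDiff ℝ (⊤ : ℕ∞) (fun p : ℝ × ℝ => u p.1 p.2) ∧
    ∀ x t : ℝ,
      (deriv (fun s => η x s) t + deriv (fun y => u y t) x +
        deriv (fun y => η y t * u y t) x +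
        (-7 / 30 : ℝ) * iteratedDeriv 3 (fun y => u y t) x -
        (7 / 15 : ℝ) * iteratedDeriv 2 (fun y => deriv (fun s => η y s) t) x = 0) ∧
      (deriv (fun s => u x s) t + deriv (fun y => η y t) x +
        deriv (fun y => (u y t) ^ 2 / 2) x +
        (-2 / 5 : ℝ) * iteratedDeriv 3 (fun y => η y t) x -
        (1 / 2 : ℝ) * iteratedDeriv 2 (fun y => deriv (fun s => u y s) t) x = 0) := by
  have hη' : η = fun x t => 3 / 8 * sechSq (1 / 2 * √(5 / 7) * (x - 20 - 5 * √2 / 6 * t)) :=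
    funext₂ hη
  have hu' : u = fun x t => √2 / 4 * sechSq (1 / 2 * √(5 / 7) * (x - 20 - 5 * √2 / 6 * t)) := by
    funext x t
    have hs : (1 : ℝ) / (2 * √2) = √2 / 4 := by
      field_simp
      norm_num
    rw [hu, hs, sechSq]
  have hk : (1 / 2 * √(5 / 7) : ℝ) ^ 2 = 5 / 28 := by
    rw [mul_pow, Real.sq_sqrt (by norm_num)]
    norm_num
  have h2 : √2 ^ 2 = (2 : ℝ) := Real.sq_sqrt (by norm_num)
  subst hη' hu'
  clear hη hu
  generalize 1 / 2 * √(5 / 7 : ℝ) = k at *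
  refine ⟨contDiff_const.mul (contDiff_sechSq.comp (by fun_prop)),
    contDiff_const.mul (contDiff_sechSq.comp (by fun_prop)), fun x t => ?_⟩
  have hprod : (fun y => 3 / 8 * sechSq (k * (y - 20 - 5 * √2 / 6 * t)) *
      (√2 / 4 * sechSq (k * (y - 20 - 5 * √2 / 6 * t)))) =
      fun y => 3 * √2 / 32 * sechSq (k * (y - 20 - 5 * √2 / 6 * t)) ^ 2 := by
    funext y
    ring
  have hsq : (fun y => (√2 / 4 * sechSq (k * (y - 20 - 5 * √2 / 6 * t))) ^ 2 / 2) =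
      fun y => 1 / 16 * sechSq (k * (y - 20 - 5 * √2 / 6 * t)) ^ 2 := by
    funext y
    rw [mul_pow, div_pow, h2]
    ring
  simp only [hprod, hsq, deriv_time_sechSq_wave, deriv_sechSq_wave, deriv_mul_sechSq_wave,
    iteratedDeriv_two_sechSqDeriv_wave, iteratedDeriv_three_sechSq_wave]
  generalize sechSq _ = S
  generalize sechSqDeriv _ = D
  constructor
  · linear_combination (√2 * 7 / 80 * k * (4 - 12 * S) * D) * hk
  · linear_combination (7 / 120 * k * (4 - 12 * S) * D) * hk +
      (-5 / 24 * k * D + 5 / 48 * k ^ 3 * (4 - 12 * S) * D) * h2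
end

section
/- Fix σ ∈ {+1, −1} and set γ = 3/√10. Define η(x,t) = (15/2)·sech²(γ·(x + σ·(5/2)t)) − (45/4)·sech⁴(γ·(x + σ·(5/2)t)) and u(x,t) = −σ·(15/2)·sech²(γ·(x + σ·(5/2)t)). Then η and u are smooth on ℝ² and satisfy, at every point (x,t) ∈ ℝ², the abcd Boussinesq system with parameters a = c = 0 and b = d = 1/6, that is, ∂ₜη + ∂ₓu + ∂ₓ(ηu) − (1/6)·∂ₓ²∂ₜη = 0 and ∂ₜu + ∂ₓη + ∂ₓ(u²/2) − (1/6)·∂ₓ²∂ₜu = 0. -/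
open Real in
theorem hasDerivAt_sech_pow (n : ℕ) (z : ℝ) :
    HasDerivAt (fun z => (1 / cosh z) ^ n) (-(n * tanh z * (1 / cosh z) ^ n)) z := by
  have hc : cosh z ≠ 0 := (cosh_pos z).ne'
  simp only [one_div, inv_pow]
  refine (((hasDerivAt_cosh z).fun_pow n).fun_inv (pow_ne_zero n hc)).congr_deriv ?_
  rcases n with _ | n
  · simp
  · rw [tanh_eq_sinh_div_cosh]
    simp only [Nat.add_sub_cancel]
    field_simp
    ring

open Real in
theorem hasDerivAt_tanh_mul_sech_pow (n : ℕ) (z : ℝ) :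
    HasDerivAt (fun z => tanh z * (1 / cosh z) ^ n)
      ((n + 1) * (1 / cosh z) ^ (n + 2) - n * (1 / cosh z) ^ n) z := by
  have hc : cosh z ≠ 0 := (cosh_pos z).ne'
  have htanh : HasDerivAt tanh ((1 / cosh z) ^ 2) z := by
    have h := (hasDerivAt_sinh z).fun_div (hasDerivAt_cosh z) hc
    simp only [← tanh_eq_sinh_div_cosh] at h
    refine h.congr_deriv ?_
    rw [one_div_pow]
    congr 1
    linear_combination cosh_sq z
  refine (htanh.mul (hasDerivAt_sech_pow n z)).congr_deriv ?_
  have h : tanh z ^ 2 = 1 - (1 / cosh z) ^ 2 := by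
    rw [tanh_eq_sinh_div_cosh]
    field_simp
    linear_combination -cosh_sq z
  linear_combination -(n : ℝ) * (1 / cosh z) ^ n * h

theorem hasDerivAt_travelingWave_space {F F' : ℝ → ℝ} (hF : ∀ z, HasDerivAt F (F' z) z)
    (k c x t : ℝ) :
    HasDerivAt (fun y => F (k * (y + c * t))) (k * F' (k * (x + c * t))) x := by
  have h : HasDerivAt (fun y => k * (y + c * t)) (k * 1) x :=
    ((hasDerivAt_id x).add_const (c * t)).const_mul k
  exact ((hF _).comp x h).congr_deriv (by ring)

theorem hasDerivAt_travelingWave_time {F F' : ℝ → ℝ} (hF : ∀ z, HasDerivAt F (F' z) z)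
    (k c x t : ℝ) :
    HasDerivAt (fun s => F (k * (x + c * s))) (k * c * F' (k * (x + c * t))) t := by
  have h : HasDerivAt (fun s => k * (x + c * s)) (k * (c * 1)) t :=
    (((hasDerivAt_id t).const_mul c).const_add x).const_mul k
  exact ((hF _).comp t h).congr_deriv (by ring)

theorem iteratedDeriv_two_deriv_travelingWave {F F₁ F₂ F₃ : ℝ → ℝ}
    (h₁ : ∀ z, HasDerivAt F (F₁ z) z) (h₂ : ∀ z, HasDerivAt F₁ (F₂ z) z)
    (h₃ : ∀ z, HasDerivAt F₂ (F₃ z) z) (k c x t : ℝ) :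
    iteratedDeriv 2 (fun y => deriv (fun s => F (k * (y + c * s))) t) x =
      k ^ 3 * c * F₃ (k * (x + c * t)) := by
  have e₁ : (fun y => deriv (fun s => F (k * (y + c * s))) t) =
      fun y => k * c * F₁ (k * (y + c * t)) :=
    funext fun y => (hasDerivAt_travelingWave_time h₁ k c y t).deriv
  have e₂ : deriv (fun y => k * c * F₁ (k * (y + c * t))) =
      fun y => k * c * (k * F₂ (k * (y + c * t))) :=
    funext fun y => ((hasDerivAt_travelingWave_space h₂ k c y t).const_mul (k * c)).deriv
  rw [e₁, iteratedDeriv_succ, iteratedDeriv_one, e₂,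
    (((hasDerivAt_travelingWave_space h₃ k c x t).const_mul k).const_mul (k * c)).deriv]
  ring

open Real in
theorem hasDerivAt_sech_sq_add_sech_four (A B : ℝ) (z : ℝ) :
    HasDerivAt (fun z => A * (1 / cosh z) ^ 2 + B * (1 / cosh z) ^ 4)
      (-2 * A * (tanh z * (1 / cosh z) ^ 2) + -4 * B * (tanh z * (1 / cosh z) ^ 4)) z :=
  (((hasDerivAt_sech_pow 2 z).const_mul A).add
    ((hasDerivAt_sech_pow 4 z).const_mul B)).congr_deriv (by push_cast; ring)

open Real in
theorem hasDerivAt_deriv_sech_sq_add_sech_four (A B : ℝ) (z : ℝ) :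
    HasDerivAt
      (fun z => -2 * A * (tanh z * (1 / cosh z) ^ 2) + -4 * B * (tanh z * (1 / cosh z) ^ 4))
      (4 * A * (1 / cosh z) ^ 2 + (16 * B - 6 * A) * (1 / cosh z) ^ 4
        + -20 * B * (1 / cosh z) ^ 6) z :=
  (((hasDerivAt_tanh_mul_sech_pow 2 z).const_mul (-2 * A)).add
    ((hasDerivAt_tanh_mul_sech_pow 4 z).const_mul (-4 * B))).congr_deriv (by push_cast; ring)

open Real in
theorem hasDerivAt_deriv_deriv_sech_sq_add_sech_four (A B : ℝ) (z : ℝ) :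
    HasDerivAt
      (fun z => 4 * A * (1 / cosh z) ^ 2 + (16 * B - 6 * A) * (1 / cosh z) ^ 4
        + -20 * B * (1 / cosh z) ^ 6)
      (-(tanh z * (8 * A * (1 / cosh z) ^ 2 + (64 * B - 24 * A) * (1 / cosh z) ^ 4
        - 120 * B * (1 / cosh z) ^ 6))) z :=
  ((((hasDerivAt_sech_pow 2 z).const_mul (4 * A)).add
    ((hasDerivAt_sech_pow 4 z).const_mul (16 * B - 6 * A))).add
    ((hasDerivAt_sech_pow 6 z).const_mul (-20 * B))).congr_deriv (by push_cast; ring)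

open Real in
theorem contDiff_sech_sq_add_sech_four_travelingWave (A B k c : ℝ) :
    ContDiff ℝ (⊤ : ℕ∞) (fun p : ℝ × ℝ =>
      A * (1 / cosh (k * (p.1 + c * p.2))) ^ 2 + B * (1 / cosh (k * (p.1 + c * p.2))) ^ 4) := by
  have harg : ContDiff ℝ (⊤ : ℕ∞) (fun p : ℝ × ℝ => k * (p.1 + c * p.2)) := by fun_prop
  have hsech : ContDiff ℝ (⊤ : ℕ∞) (fun p : ℝ × ℝ => 1 / cosh (k * (p.1 + c * p.2))) :=
    contDiff_const.div harg.cosh fun p => (cosh_pos _).ne'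
  exact (contDiff_const.mul (hsech.pow 2)).add (contDiff_const.mul (hsech.pow 4))


/-- For σ = ±1, the traveling-wave pair (η, u) is smooth and solves the
BBM-BBM system (a = c = 0, b = d = 1/6). -/
theorem bbm_bbm_traveling_wave
    (σ : ℝ) (hσ : σ = 1 ∨ σ = -1)
    (η u : ℝ → ℝ → ℝ)
    (hη : ∀ x t : ℝ, η x t =
      15 / 2 * (1 / Real.cosh (3 / Real.sqrt 10 * (x + σ * (5 / 2) * t))) ^ 2 -
      45 / 4 * (1 / Real.cosh (3 / Real.sqrt 10 * (x + σ * (5 / 2) * t))) ^ 4)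
    (hu : ∀ x t : ℝ, u x t =
      -σ * (15 / 2) * (1 / Real.cosh (3 / Real.sqrt 10 * (x + σ * (5 / 2) * t))) ^ 2) :
    ContDiff ℝ (⊤ : ℕ∞) (fun p : ℝ × ℝ => η p.1 p.2) ∧
    ContDiff ℝ (⊤ : ℕ∞) (fun p : ℝ × ℝ => u p.1 p.2) ∧
    ∀ x t : ℝ,
      (deriv (fun s => η x s) t + deriv (fun y => u y t) x +
        deriv (fun y => η y t * u y t) x -
        (1 / 6 : ℝ) * iteratedDeriv 2 (fun y => deriv (fun s => η y s) t) x = 0) ∧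
      (deriv (fun s => u x s) t + deriv (fun y => η y t) x +
        deriv (fun y => (u y t) ^ 2 / 2) x -
        (1 / 6 : ℝ) * iteratedDeriv 2 (fun y => deriv (fun s => u y s) t) x = 0) := by
  set k : ℝ := 3 / √10 with hk
  have hk2 : k ^ 2 = 9 / 10 := by
    rw [hk, div_pow, Real.sq_sqrt (by norm_num)]
    norm_num
  have hσ2 : σ ^ 2 = 1 := by rcases hσ with rfl | rfl <;> norm_num
  set W : ℝ → ℝ → ℝ → ℝ := fun A B z => A * (1 / Real.cosh z) ^ 2 + B * (1 / Real.cosh z) ^ 4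
    with hW
  obtain rfl : η = fun x t => W (15 / 2) (-(45 / 4)) (k * (x + σ * (5 / 2) * t)) := by
    funext x t
    rw [hη]
    ring
  obtain rfl : u = fun x t => W (-σ * (15 / 2)) 0 (k * (x + σ * (5 / 2) * t)) := by
    funext x t
    rw [hu]
    ring
  refine ⟨contDiff_sech_sq_add_sech_four_travelingWave _ _ _ _,
    contDiff_sech_sq_add_sech_four_travelingWave _ _ _ _, fun x t => ?_⟩
  have h₁ := hasDerivAt_sech_sq_add_sech_four
  have hη_x := hasDerivAt_travelingWave_space (h₁ (15 / 2) (-(45 / 4))) k (σ * (5 / 2)) x t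
  have hu_x := hasDerivAt_travelingWave_space (h₁ (-σ * (15 / 2)) 0) k (σ * (5 / 2)) x t
  have hη_t := hasDerivAt_travelingWave_time (h₁ (15 / 2) (-(45 / 4))) k (σ * (5 / 2)) x t
  have hu_t := hasDerivAt_travelingWave_time (h₁ (-σ * (15 / 2)) 0) k (σ * (5 / 2)) x t
  have hxxt (A B : ℝ) := iteratedDeriv_two_deriv_travelingWave (h₁ A B)
    (hasDerivAt_deriv_sech_sq_add_sech_four A B)
    (hasDerivAt_deriv_deriv_sech_sq_add_sech_four A B) k (σ * (5 / 2)) x t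
  have hηu_x := (hη_x.fun_mul hu_x).deriv
  have huu_x := ((hu_x.fun_pow 2).div_const 2).deriv
  simp only [hW]
  rw [hη_t.deriv, hu_x.deriv, hηu_x, hxxt, hu_t.deriv, hη_x.deriv, huu_x, hxxt]
  generalize Real.tanh (k * (x + σ * (5 / 2) * t)) = T
  generalize 1 / Real.cosh (k * (x + σ * (5 / 2) * t)) = q
  have hk3 : k ^ 3 = 9 / 10 * k := by rw [pow_succ, hk2]
  rw [hk3]
  constructor
  · ring
  · push_cast
    ring_nf
    rw [hσ2]
    ring
end

section
/- (Inverse inequality, trace form.) For every natural number k there exists a constant C > 0, depending only on k, such that for every real interval [α, β] with α < β and every real polynomial p of degree at most k, (p(α))² + (p(β))² ≤ C·(β − α)⁻¹·∫_α^β (p(x))² dx. -/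
open Polynomial in
/-- Integration of polynomials over `[0, 1]`, as a linear functional. -/
noncomputable def polynomialIntegral : ℝ[X] →ₗ[ℝ] ℝ where
  toFun p := ∫ x in (0 : ℝ)..1, p.eval x
  map_add' p q := by
    simp only [Polynomial.eval_add]
    exact intervalIntegral.integral_add (p.continuous.intervalIntegrable _ _)
      (q.continuous.intervalIntegrable _ _)
  map_smul' c p := by
    simp [Polynomial.eval_smul]

open Polynomial in
lemma polynomialIntegral_apply (p : ℝ[X]) :
    polynomialIntegral p = ∫ x in (0 : ℝ)..1, p.eval x := rfl

open Polynomial in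
lemma polynomialIntegral_sq (p : ℝ[X]) :
    polynomialIntegral (p * p) = ∫ x in (0 : ℝ)..1, p.eval x ^ 2 := by
  simp [polynomialIntegral_apply, sq]

open Polynomial in
lemma polynomialIntegral_mul_self_nonneg (p : ℝ[X]) : 0 ≤ polynomialIntegral (p * p) := by
  rw [polynomialIntegral_sq]
  exact intervalIntegral.integral_nonneg zero_le_one fun x _ => sq_nonneg _

open Polynomial in
lemma eq_zero_of_polynomialIntegral_mul_self {p : ℝ[X]} (h : polynomialIntegral (p * p) = 0) :
    p = 0 := by
  rw [polynomialIntegral_sq] at h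
  refine p.eq_zero_of_infinite_isRoot
    ((Set.Icc_infinite (zero_lt_one (α := ℝ))).mono fun c hc => ?_)
  by_contra hne
  have hpos : 0 < ∫ x in (0 : ℝ)..1, p.eval x ^ 2 :=
    intervalIntegral.integral_pos zero_lt_one (p.continuous.pow 2).continuousOn
      (fun x _ => sq_nonneg _) ⟨c, hc, sq_pos_of_ne_zero hne⟩
  exact hpos.ne' h

open Polynomial in
/-- Riesz representation on polynomials of bounded degree, for the `L²` product on `[0, 1]`. -/
lemma exists_polynomialIntegral_mul_eq (k : ℕ) (φ : ℝ[X] →ₗ[ℝ] ℝ) :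
    ∃ r : ℝ[X], ∀ p : ℝ[X], p.natDegree ≤ k → polynomialIntegral (r * p) = φ p := by
  let V := degreeLE ℝ (k : WithBot ℕ)
  have hV : Module.Finite ℝ V := by
    change Module.Finite ℝ (degreeLE ℝ (k : WithBot ℕ))
    rw [degreeLE_eq_span_X_pow]
    exact Module.Finite.span_finset _ _
  let B : V →ₗ[ℝ] Module.Dual ℝ V :=
    ((LinearMap.mul ℝ ℝ[X]).compr₂ polynomialIntegral).domRestrict₁₂ V V
  have hB : Function.Injective B := by
    rw [injective_iff_map_eq_zero]
    intro q hq
    exact Subtype.ext (eq_zero_of_polynomialIntegral_mul_self (LinearMap.congr_fun hq q))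
  obtain ⟨r, hr⟩ := (LinearMap.injective_iff_surjective_of_finrank_eq_finrank
    Subspace.dual_finrank_eq.symm).mp hB (φ.domRestrict V)
  exact ⟨r, fun p hp => LinearMap.congr_fun hr
    ⟨p, mem_degreeLE.mpr (natDegree_le_iff_degree_le.mp hp)⟩⟩

open Polynomial in
/-- Linear functionals on polynomials of bounded degree are bounded in the `L²` norm. -/
lemma exists_sq_le_mul_integral_sq (k : ℕ) (φ : ℝ[X] →ₗ[ℝ] ℝ) :
    ∃ C : ℝ, 0 < C ∧ ∀ p : ℝ[X], p.natDegree ≤ k →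
      φ p ^ 2 ≤ C * ∫ x in (0 : ℝ)..1, p.eval x ^ 2 := by
  obtain ⟨r, hr⟩ := exists_polynomialIntegral_mul_eq k φ
  have hA := polynomialIntegral_mul_self_nonneg r
  set c := polynomialIntegral (r * r) + 1 with hc
  refine ⟨c, by positivity, fun p hp => ?_⟩
  rw [← polynomialIntegral_sq]
  have h := polynomialIntegral_mul_self_nonneg (c • p - φ p • r)
  have hexp : (c • p - φ p • r) * (c • p - φ p • r) =
      c ^ 2 • (p * p) - (2 * c * φ p) • (r * p) + φ p ^ 2 • (r * r) := by
    simp only [smul_eq_C_mul, map_mul, map_pow, map_ofNat]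
    ring
  rw [hexp, map_add, map_sub, map_smul, map_smul, map_smul, hr p hp] at h
  simp only [smul_eq_mul] at h
  have hcpos : 0 < c := by positivity
  refine le_of_mul_le_mul_left ?_ hcpos
  have hrr : polynomialIntegral (r * r) = c - 1 := by rw [hc]; ring
  rw [hrr] at h
  nlinarith [sq_nonneg (φ p)]

/-- Inverse inequality, trace form: for each degree bound k there is
C > 0 with p(α)² + p(β)² ≤ C (β-α)⁻¹ ∫_α^β p² for all polynomials of degree ≤ k. -/
theorem inverse_inequality_trace (k : ℕ) :
    ∃ C : ℝ, 0 < C ∧ ∀ α β : ℝ, α < β → ∀ p : Polynomial ℝ, p.natDegree ≤ k →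
      p.eval α ^ 2 + p.eval β ^ 2 ≤
        C * (β - α)⁻¹ * ∫ x in α..β, p.eval x ^ 2 := by
  obtain ⟨C₀, hC₀, h₀⟩ := exists_sq_le_mul_integral_sq k (Polynomial.leval 0)
  obtain ⟨C₁, hC₁, h₁⟩ := exists_sq_le_mul_integral_sq k (Polynomial.leval 1)
  refine ⟨C₀ + C₁, by positivity, fun α β hαβ p hp => ?_⟩
  set q := p.comp (Polynomial.C (β - α) * Polynomial.X + Polynomial.C α) with hq
  have hqk : q.natDegree ≤ k := by
    refine Polynomial.natDegree_comp_le.trans ?_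
    calc p.natDegree * _ ≤ k * 1 := Nat.mul_le_mul hp Polynomial.natDegree_linear_le
      _ = k := mul_one k
  have hint : ∫ x in (0 : ℝ)..1, q.eval x ^ 2 = (β - α)⁻¹ * ∫ x in α..β, p.eval x ^ 2 := by
    have := intervalIntegral.integral_comp_mul_add (a := 0) (b := 1)
      (fun x => p.eval x ^ 2) (sub_pos.mpr hαβ).ne' α
    simpa [hq] using this
  have hq₀ := h₀ q hqk
  have hq₁ := h₁ q hqk
  rw [hint] at hq₀ hq₁
  simp only [Polynomial.leval_apply, hq, Polynomial.eval_comp, Polynomial.eval_add,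
    Polynomial.eval_mul, Polynomial.eval_C, Polynomial.eval_X, mul_zero, zero_add, mul_one,
    sub_add_cancel] at hq₀ hq₁
  rw [mul_assoc, add_mul]
  exact add_le_add hq₀ hq₁
end

section
/- (Existence and uniqueness of the right Radau projection P⁻.) Let k ≥ 1 be a natural number, let [α, β] ⊂ ℝ with α < β, and let g : [α, β] → ℝ be continuous. Then there exists a unique real polynomial p of degree at most k such that ∫_α^β (p(x) − g(x))·q(x) dx = 0 for every real polynomial q of degree at most k − 1, and p(β) = g(β). (Symmetrically, there is a unique polynomial of degree at most k satisfying the same moment conditions together with the left-endpoint condition p(α) = g(α); this defines the left Radau projection P⁺.) -/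
open Polynomial in
/-- The pairing `(p, q) ↦ ∫ p q` over an interval, as a bilinear form on real polynomials. -/
noncomputable def intervalPairing (α β : ℝ) : ℝ[X] →ₗ[ℝ] ℝ[X] →ₗ[ℝ] ℝ :=
  LinearMap.mk₂ ℝ (fun p q => ∫ x in α..β, p.eval x * q.eval x)
    (fun p₁ p₂ q => by
      simp only [Polynomial.eval_add, add_mul]
      exact intervalIntegral.integral_add
        ((p₁.continuous.mul q.continuous).intervalIntegrable _ _)
        ((p₂.continuous.mul q.continuous).intervalIntegrable _ _))
    (fun c p q => by simp [mul_assoc])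
    (fun p q₁ q₂ => by
      simp only [Polynomial.eval_add, mul_add]
      exact intervalIntegral.integral_add
        ((p.continuous.mul q₁.continuous).intervalIntegrable _ _)
        ((p.continuous.mul q₂.continuous).intervalIntegrable _ _))
    (fun c p q => by simp [mul_left_comm])

open Polynomial in
/-- Integration of polynomials against a function continuous on the interval. -/
noncomputable def intervalMoment {α β : ℝ} (hαβ : α ≤ β) (g : ℝ → ℝ)
    (hg : ContinuousOn g (Set.Icc α β)) : ℝ[X] →ₗ[ℝ] ℝ where
  toFun q := ∫ x in α..β, g x * q.eval x
  map_add' q₁ q₂ := by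
    simp only [Polynomial.eval_add, mul_add]
    exact intervalIntegral.integral_add
      ((hg.mul q₁.continuous.continuousOn).intervalIntegrable_of_Icc hαβ)
      ((hg.mul q₂.continuous.continuousOn).intervalIntegrable_of_Icc hαβ)
  map_smul' c q := by simp [mul_left_comm]

theorem integral_sub_mul_eval_eq {α β : ℝ} (hαβ : α ≤ β) (g : ℝ → ℝ)
    (hg : ContinuousOn g (Set.Icc α β)) (p q : Polynomial ℝ) :
    ∫ x in α..β, (p.eval x - g x) * q.eval x =
      intervalPairing α β p q - intervalMoment hαβ g hg q := by
  simp only [sub_mul]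
  exact intervalIntegral.integral_sub
    ((p.continuous.mul q.continuous).intervalIntegrable _ _)
    ((hg.mul q.continuous.continuousOn).intervalIntegrable_of_Icc hαβ)

/-- A polynomial is zero if its square has vanishing integral against the weight `x - c`,
where `c` is not an interior point of the interval. -/
theorem Polynomial.eq_zero_of_integral_sub_mul_sq_eq_zero {α β c : ℝ} (hαβ : α < β)
    (hc : c ≤ α ∨ β ≤ c) (r : Polynomial ℝ)
    (h : ∫ x in α..β, (x - c) * r.eval x ^ 2 = 0) : r = 0 := by
  by_contra hr
  obtain ⟨y, hy, hy0⟩ : ∃ y ∈ Set.Ioo α β, r.eval y ≠ 0 := by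
    by_contra! hzero
    exact hr (r.eq_zero_of_infinite_isRoot ((Set.Ioo_infinite hαβ).mono hzero))
  have hsq : 0 < r.eval y ^ 2 := by positivity
  have hr_cont := r.continuous
  rcases hc with hc | hc
  · refine (intervalIntegral.integral_pos hαβ (f := fun x => (x - c) * r.eval x ^ 2)
      (by fun_prop) (fun x hx => ?_) ⟨y, Set.Ioo_subset_Icc_self hy, ?_⟩).ne' h
    · exact mul_nonneg (by linarith [hx.1]) (sq_nonneg _)
    · exact mul_pos (by linarith [hy.1]) hsq
  · have hpos := intervalIntegral.integral_pos hαβ (f := fun x => -((x - c) * r.eval x ^ 2))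
      (by fun_prop) (fun x hx => ?_) ⟨y, Set.Ioo_subset_Icc_self hy, ?_⟩
    · rw [intervalIntegral.integral_neg, h] at hpos
      simp at hpos
    · rw [← neg_mul]
      exact mul_nonneg (by linarith [hx.2]) (sq_nonneg _)
    · rw [← neg_mul]
      exact mul_pos (by linarith [hy.2]) hsq

open Polynomial in
/-- The moments of a polynomial against polynomials of degree `< k`, and its value at `c`. -/
noncomputable def radauMap (k : ℕ) (α β c : ℝ) :
    degreeLT ℝ (k + 1) →ₗ[ℝ] Module.Dual ℝ (degreeLT ℝ k) × ℝ :=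
  ((LinearMap.lcomp ℝ ℝ (degreeLT ℝ k).subtype ∘ₗ intervalPairing α β).prod
    (Polynomial.leval c)) ∘ₗ (degreeLT ℝ (k + 1)).subtype

theorem radauMap_injective (k : ℕ) {α β c : ℝ} (hαβ : α < β) (hc : c ≤ α ∨ β ≤ c) :
    Function.Injective (radauMap k α β c) := by
  rw [injective_iff_map_eq_zero]
  rintro ⟨p, hp⟩ h
  have hroot : p.eval c = 0 := congrArg Prod.snd h
  obtain ⟨r, rfl⟩ := Polynomial.dvd_iff_isRoot.mpr hroot
  have hr : r ∈ Polynomial.degreeLT ℝ k := by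
    rcases eq_or_ne r 0 with rfl | hr0
    · exact zero_mem _
    rw [Polynomial.mem_degreeLT, Polynomial.degree_mul, Polynomial.degree_X_sub_C,
      Polynomial.degree_eq_natDegree hr0] at hp
    rw [Polynomial.mem_degreeLT, Polynomial.degree_eq_natDegree hr0]
    norm_cast at hp ⊢
    omega
  have hint : ∫ x in α..β, ((Polynomial.X - Polynomial.C c) * r).eval x * r.eval x = 0 :=
    DFunLike.congr_fun (congrArg Prod.fst h) ⟨r, hr⟩
  have hr0 : r = 0 := r.eq_zero_of_integral_sub_mul_sq_eq_zero hαβ hc (by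
    simpa [mul_assoc, sq] using hint)
  simp [hr0]

theorem radauMap_bijective (k : ℕ) {α β c : ℝ} (hαβ : α < β) (hc : c ≤ α ∨ β ≤ c) :
    Function.Bijective (radauMap k α β c) := by
  have (n : ℕ) : Module.Finite ℝ (Polynomial.degreeLT ℝ n) :=
    Module.Finite.equiv (Polynomial.degreeLTEquiv ℝ n).symm
  have hfinrank (n : ℕ) : Module.finrank ℝ (Polynomial.degreeLT ℝ n) = n := by
    simp [(Polynomial.degreeLTEquiv ℝ n).finrank_eq]
  have hinj := radauMap_injective k hαβ hc
  refine ⟨hinj, (LinearMap.injective_iff_surjective_of_finrank_eq_finrank ?_).mp hinj⟩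
  rw [Module.finrank_prod, Subspace.dual_finrank_eq, hfinrank, hfinrank, Module.finrank_self]

theorem Polynomial.mem_degreeLT_succ_iff_natDegree_le {R : Type*} [Semiring R] {n : ℕ}
    {p : Polynomial R} : p ∈ Polynomial.degreeLT R (n + 1) ↔ p.natDegree ≤ n := by
  simp only [Polynomial.mem_degreeLT, Polynomial.degree_lt_iff_coeff_zero,
    Polynomial.natDegree_le_iff_coeff_eq_zero, Nat.succ_le_iff]

/-- Unique solvability of the moment conditions up to degree `k - 1` together with
interpolation at a point `c` outside the interior of the interval. -/
theorem existsUnique_moments_eq_and_eval_eq {k : ℕ} (hk : 1 ≤ k) {α β c : ℝ} (hαβ : α < β)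
    (hc : c ≤ α ∨ β ≤ c) (g : ℝ → ℝ) (hg : ContinuousOn g (Set.Icc α β)) :
    ∃! p : Polynomial ℝ, p.natDegree ≤ k ∧
      (∀ q : Polynomial ℝ, q.natDegree ≤ k - 1 →
        ∫ x in α..β, (p.eval x - g x) * q.eval x = 0) ∧
      p.eval c = g c := by
  obtain ⟨m, rfl⟩ := Nat.exists_eq_add_of_le' hk
  have hiff (p : Polynomial.degreeLT ℝ (m + 1 + 1)) :
      radauMap (m + 1) α β c p =
        (intervalMoment hαβ.le g hg ∘ₗ (Polynomial.degreeLT ℝ (m + 1)).subtype, g c) ↔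
      (∀ q : Polynomial ℝ, q.natDegree ≤ m →
        ∫ x in α..β, (p.1.eval x - g x) * q.eval x = 0) ∧ p.1.eval c = g c := by
    simp only [integral_sub_mul_eval_eq hαβ.le g hg, sub_eq_zero,
      ← Polynomial.mem_degreeLT_succ_iff_natDegree_le, Prod.ext_iff, LinearMap.ext_iff,
      Subtype.forall]
    rfl
  obtain ⟨p, hp, huniq⟩ := (radauMap_bijective (m + 1) hαβ hc).existsUnique
    (intervalMoment hαβ.le g hg ∘ₗ (Polynomial.degreeLT ℝ (m + 1)).subtype, g c)
  refine ⟨p, ⟨Polynomial.mem_degreeLT_succ_iff_natDegree_le.mp p.2, (hiff p).mp hp⟩, ?_⟩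
  rintro p' ⟨hdeg, hp'⟩
  exact congrArg Subtype.val (huniq ⟨p', Polynomial.mem_degreeLT_succ_iff_natDegree_le.mpr hdeg⟩
    ((hiff _).mpr hp'))

/-- Existence and uniqueness of the Radau projections: for k ≥ 1 and a
continuous g on [α, β], there is a unique polynomial of degree ≤ k matching all moments
of g against polynomials of degree ≤ k-1 and matching g at the right endpoint (the right
Radau projection P⁻g); symmetrically for the left endpoint (P⁺g). -/
theorem radau_projection_exists_unique
    (k : ℕ) (hk : 1 ≤ k) (α β : ℝ) (hαβ : α < β)
    (g : ℝ → ℝ) (hg : ContinuousOn g (Set.Icc α β)) :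
    (∃! p : Polynomial ℝ, p.natDegree ≤ k ∧
      (∀ q : Polynomial ℝ, q.natDegree ≤ k - 1 →
        ∫ x in α..β, (p.eval x - g x) * q.eval x = 0) ∧
      p.eval β = g β) ∧
    (∃! p : Polynomial ℝ, p.natDegree ≤ k ∧
      (∀ q : Polynomial ℝ, q.natDegree ≤ k - 1 →
        ∫ x in α..β, (p.eval x - g x) * q.eval x = 0) ∧
      p.eval α = g α) :=
  ⟨existsUnique_moments_eq_and_eval_eq hk hαβ (Or.inr le_rfl) g hg,
    existsUnique_moments_eq_and_eval_eq hk hαβ (Or.inl le_rfl) g hg⟩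
end

section
/- (Approximation property of the Radau projection.) For every natural number k ≥ 1 there exists a constant C > 0, depending only on k, with the following property. Let [α, β] ⊂ ℝ with α < β, set h = β − α, and let g : [α, β] → ℝ be (k+1)-times continuously differentiable with M = sup_{x ∈ [α,β]} |g^{(k+1)}(x)|. Let p = P⁻g be the unique polynomial of degree at most k satisfying ∫_α^β (p − g)·q dx = 0 for all polynomials q of degree at most k − 1 and p(β) = g(β). Then (∫_α^β (p(x) − g(x))² dx)^{1/2} ≤ C·M·h^{k+3/2} and sup_{x∈[α,β]} |p(x) − g(x)| ≤ C·M·h^{k+1}. -/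
/-- On polynomials of degree at most `n`, the sup norm over `[0, 1]` is controlled by the `L²` norm
with weight `1 - t`. -/
theorem Polynomial.exists_sq_eval_le_integral_unit (n : ℕ) :
    ∃ C : ℝ, 0 < C ∧ ∀ s : Polynomial ℝ, s.natDegree ≤ n → ∀ x ∈ Set.Icc (0 : ℝ) 1,
      s.eval x ^ 2 ≤ C * ∫ t in (0 : ℝ)..1, (1 - t) * s.eval t ^ 2 := by
  let E : (Fin (n + 1) → ℝ) → ℝ → ℝ := fun a t => ∑ i, a i * t ^ (i : ℕ)
  let F : (Fin (n + 1) → ℝ) → ℝ := fun a => ∫ t in (0 : ℝ)..1, (1 - t) * E a t ^ 2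
  have hF : Continuous F := by
    apply intervalIntegral.continuous_parametric_intervalIntegral_of_continuous'
    simp only [E, Function.uncurry_def]
    fun_prop
  have hE_smul (c : ℝ) (a : Fin (n + 1) → ℝ) (t : ℝ) : E (c • a) t = c * E a t := by
    simp [E, Finset.mul_sum, mul_assoc]
  have hF_smul (c : ℝ) (a : Fin (n + 1) → ℝ) : F (c • a) = c ^ 2 * F a := by
    simp only [F, ← intervalIntegral.integral_const_mul, hE_smul]
    congr 1
    ext t
    ring
  have hE_le (a : Fin (n + 1) → ℝ) (x : ℝ) (hx : x ∈ Set.Icc (0 : ℝ) 1) :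
      |E a x| ≤ (n + 1) * ‖a‖ := by
    calc |E a x| ≤ ∑ i, |a i * x ^ (i : ℕ)| := Finset.abs_sum_le_sum_abs _ _
      _ ≤ ∑ _i : Fin (n + 1), ‖a‖ := by
          refine Finset.sum_le_sum fun i _ => ?_
          rw [abs_mul, abs_of_nonneg (pow_nonneg hx.1 _)]
          exact (mul_le_of_le_one_right (abs_nonneg _) (pow_le_one₀ hx.1 hx.2)).trans
            (norm_le_pi_norm a i)
      _ = (n + 1) * ‖a‖ := by simp
  have hF_pos (a : Fin (n + 1) → ℝ) (ha : a ≠ 0) : 0 < F a := by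
    let s : Polynomial ℝ := ∑ i, Polynomial.C (a i) * Polynomial.X ^ (i : ℕ)
    have hs (t : ℝ) : s.eval t = E a t := by simp [s, E, Polynomial.eval_finsetSum]
    have hs0 : s ≠ 0 := by
      intro h
      apply ha
      ext j
      have := congrArg (fun q => q.coeff (j : ℕ)) h
      simpa [s, Polynomial.finsetSum_coeff, Polynomial.coeff_X_pow, Fin.val_inj] using this
    obtain ⟨c, hc, hc0⟩ : ∃ c ∈ Set.Ioo (0 : ℝ) 1, E a c ≠ 0 := by
      by_contra! h
      refine hs0 (Polynomial.eq_zero_of_infinite_isRoot s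
        ((Set.Ioo_infinite (zero_lt_one' ℝ)).mono fun c hc => ?_))
      rw [Set.mem_ofPred_eq, Polynomial.IsRoot.def, hs, h c hc]
    refine intervalIntegral.integral_pos zero_lt_one ?_ (fun x hx => ?_) ⟨c, ⟨hc.1.le, hc.2.le⟩, ?_⟩
    · simp only [E]
      fun_prop
    · exact mul_nonneg (by linarith [hx.2]) (sq_nonneg _)
    · exact mul_pos (by linarith [hc.2]) (by positivity)
  obtain ⟨a₀, ha₀, hmin⟩ := (isCompact_sphere (0 : Fin (n + 1) → ℝ) 1).exists_isMinOn
    (NormedSpace.sphere_nonempty.2 zero_le_one) hF.continuousOn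
  have hm : 0 < F a₀ := hF_pos a₀ (ne_zero_of_mem_unit_sphere ⟨a₀, ha₀⟩)
  have hF_ge (a : Fin (n + 1) → ℝ) : ‖a‖ ^ 2 * F a₀ ≤ F a := by
    rcases eq_or_ne a 0 with rfl | ha
    · simp [F, E]
    have hn : ‖a‖ ≠ 0 := norm_ne_zero_iff.2 ha
    have hmem : ‖a‖⁻¹ • a ∈ Metric.sphere (0 : Fin (n + 1) → ℝ) 1 := by
      simp [norm_smul, hn]
    have h : F a₀ ≤ F (‖a‖⁻¹ • a) := hmin hmem
    calc ‖a‖ ^ 2 * F a₀ ≤ ‖a‖ ^ 2 * F (‖a‖⁻¹ • a) := by gcongr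
      _ = F a := by rw [hF_smul]; field_simp
  refine ⟨(n + 1) ^ 2 / F a₀, by positivity, fun s hs x hx => ?_⟩
  let a : Fin (n + 1) → ℝ := fun i => s.coeff i
  have hE (t : ℝ) : s.eval t = E a t := by
    rw [Polynomial.eval_eq_sum_range' (Nat.lt_succ_of_le hs), Finset.sum_range]
  simp only [hE]
  calc E a x ^ 2 = |E a x| ^ 2 := (sq_abs _).symm
    _ ≤ ((n + 1) * ‖a‖) ^ 2 := by gcongr; exact hE_le a x hx
    _ = (n + 1) ^ 2 / F a₀ * (‖a‖ ^ 2 * F a₀) := by field_simp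
    _ ≤ (n + 1) ^ 2 / F a₀ * F a := by gcongr; exact hF_ge a

/-- Scaled version of `Polynomial.exists_sq_eval_le_integral_unit` on an arbitrary interval. -/
theorem Polynomial.exists_sq_eval_le_integral (n : ℕ) :
    ∃ C : ℝ, 0 < C ∧ ∀ a b : ℝ, a < b → ∀ s : Polynomial ℝ, s.natDegree ≤ n →
      ∀ x ∈ Set.Icc a b,
        (s.eval x * (b - a)) ^ 2 ≤ C * ∫ t in a..b, (b - t) * s.eval t ^ 2 := by
  obtain ⟨C, hC, h⟩ := Polynomial.exists_sq_eval_le_integral_unit n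
  refine ⟨C, hC, fun a b hab s hs x hx => ?_⟩
  have hpos : 0 < b - a := sub_pos.2 hab
  let l : Polynomial ℝ := Polynomial.C (b - a) * Polynomial.X + Polynomial.C a
  have hl : l.natDegree ≤ 1 := Polynomial.natDegree_linear_le
  have hdeg : (s.comp l).natDegree ≤ n :=
    Polynomial.natDegree_comp_le.trans ((Nat.mul_le_mul hs hl).trans_eq (mul_one n))
  have heval (t : ℝ) : (s.comp l).eval t = s.eval ((b - a) * t + a) := by simp [l]
  have hint : ∫ t in a..b, (b - t) * s.eval t ^ 2 =
      (b - a) ^ 2 * ∫ t in (0 : ℝ)..1, (1 - t) * (s.comp l).eval t ^ 2 := by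
    have := intervalIntegral.mul_integral_comp_mul_add (a := 0) (b := 1)
      (f := fun t => (b - t) * s.eval t ^ 2) (b - a) a
    rw [mul_zero, zero_add, mul_one, sub_add_cancel] at this
    simp only [← this, ← intervalIntegral.integral_const_mul]
    congr 1
    ext t
    rw [heval]
    ring
  have hx' := h (s.comp l) hdeg ((x - a) / (b - a))
    ⟨div_nonneg (sub_nonneg.2 hx.1) hpos.le, (div_le_one hpos).2 (by linarith [hx.2])⟩
  rw [heval, mul_div_cancel₀ _ hpos.ne', sub_add_cancel] at hx'
  rw [hint, mul_pow]
  calc s.eval x ^ 2 * (b - a) ^ 2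
      ≤ (C * ∫ t in (0 : ℝ)..1, (1 - t) * (s.comp l).eval t ^ 2) * (b - a) ^ 2 := by gcongr
    _ = _ := by ring

/-- Stability of the right Radau projection in the sup norm, uniformly in the cell. -/
theorem exists_radau_projection_stability (k : ℕ) :
    ∃ C : ℝ, 0 < C ∧ ∀ a b : ℝ, a < b → ∀ R : ℝ → ℝ, ∀ K : ℝ,
      ContinuousOn R (Set.Icc a b) → (∀ x ∈ Set.Icc a b, |R x| ≤ K) →
      ∀ r : Polynomial ℝ, r.natDegree ≤ k →
        (∀ q : Polynomial ℝ, q.natDegree ≤ k - 1 →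
          ∫ x in a..b, (r.eval x - R x) * q.eval x = 0) →
        r.eval b = R b → ∀ x ∈ Set.Icc a b, |r.eval x - R x| ≤ C * K := by
  obtain ⟨C, hC, hs⟩ := Polynomial.exists_sq_eval_le_integral (k - 1)
  refine ⟨2 + 2 * C, by positivity, fun a b hab R K hR hK r hr horth hrb x hx => ?_⟩
  have hpos : 0 < b - a := sub_pos.2 hab
  let s := (r - Polynomial.C (R b)) /ₘ (Polynomial.X - Polynomial.C b)
  have hfac : (Polynomial.X - Polynomial.C b) * s = r - Polynomial.C (R b) :=
    Polynomial.mul_divByMonic_eq_iff_isRoot.2 (by simp [hrb])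
  have hdeg : s.natDegree ≤ k - 1 := by
    rw [Polynomial.natDegree_divByMonic _ (Polynomial.monic_X_sub_C b),
      Polynomial.natDegree_X_sub_C, Polynomial.natDegree_sub_C]
    exact Nat.sub_le_sub_right hr 1
  have heval (t : ℝ) : r.eval t = R b + (t - b) * s.eval t := by
    have := congrArg (Polynomial.eval t) hfac
    simp only [Polynomial.eval_mul, Polynomial.eval_sub, Polynomial.eval_X,
      Polynomial.eval_C] at this
    linarith
  obtain ⟨y, hy, hmax⟩ := isCompact_Icc.exists_isMaxOn (Set.nonempty_Icc.2 hab.le)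
    (f := fun t => |s.eval t|) (s.continuous.abs.continuousOn)
  have hmax (t : ℝ) (ht : t ∈ Set.Icc a b) : |s.eval t| ≤ |s.eval y| := hmax ht
  have hK0 : 0 ≤ K := (abs_nonneg _).trans (hK x hx)
  have hbK := hK b ⟨hab.le, le_rfl⟩
  have hint : ∫ t in a..b, (b - t) * s.eval t ^ 2 = ∫ t in a..b, (R b - R t) * s.eval t := by
    have h1 : IntervalIntegrable (fun t => (b - t) * s.eval t ^ 2) MeasureTheory.volume a b :=
      Continuous.intervalIntegrable (by fun_prop) a b
    have h2 : IntervalIntegrable (fun t => (r.eval t - R t) * s.eval t)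
        MeasureTheory.volume a b := by
      apply ContinuousOn.intervalIntegrable_of_Icc hab.le
      fun_prop
    rw [← add_zero (∫ t in a..b, (b - t) * s.eval t ^ 2), ← horth s hdeg,
      ← intervalIntegral.integral_add h1 h2]
    congr 1
    ext t
    rw [heval]
    ring
  have hbound : ∫ t in a..b, (R b - R t) * s.eval t ≤ 2 * K * |s.eval y| * (b - a) := by
    have := intervalIntegral.norm_integral_le_of_norm_le_const (a := a) (b := b)
      (f := fun t => (R b - R t) * s.eval t) (C := 2 * K * |s.eval y|) fun t ht => by
        rw [Set.uIoc_of_le hab.le] at ht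
        have ht' : t ∈ Set.Icc a b := ⟨ht.1.le, ht.2⟩
        rw [norm_mul, Real.norm_eq_abs, Real.norm_eq_abs]
        have h1 : |R b - R t| ≤ 2 * K := (abs_sub _ _).trans (by linarith [hK t ht'])
        exact mul_le_mul h1 (hmax t ht') (abs_nonneg _) (by positivity)
    rw [abs_of_pos hpos] at this
    exact (le_abs_self _).trans this
  have hy2 : |s.eval y| * (b - a) ≤ 2 * C * K := by
    have h1 := hs a b hab s hdeg y hy
    rw [hint, mul_pow, ← sq_abs (s.eval y), ← mul_pow] at h1
    have h2 := h1.trans (mul_le_mul_of_nonneg_left hbound hC.le)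
    rcases (mul_nonneg (abs_nonneg (s.eval y)) hpos.le).eq_or_lt with h0 | h0
    · rw [← h0]
      positivity
    · exact le_of_mul_le_mul_right (by linarith) h0
  have hxs : |(x - b) * s.eval x| ≤ 2 * C * K := by
    rw [abs_mul, mul_comm]
    refine (mul_le_mul (hmax x hx) ?_ (abs_nonneg _) (abs_nonneg _)).trans hy2
    rw [abs_le]
    constructor <;> linarith [hx.1, hx.2]
  have hxK := hK x hx
  rw [heval]
  rw [abs_le] at *
  constructor <;> linarith [hxs.1, hxs.2, hbK.1, hbK.2, hxK.1, hxK.2]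

/-- The Taylor polynomial of a real function is a polynomial of degree at most its order. -/
theorem exists_polynomial_eval_eq_taylorWithinEval (f : ℝ → ℝ) (n : ℕ) (s : Set ℝ) (a : ℝ) :
    ∃ T : Polynomial ℝ, T.natDegree ≤ n ∧ ∀ x, T.eval x = taylorWithinEval f n s a x := by
  refine ⟨∑ i ∈ Finset.range (n + 1),
    Polynomial.C ((i.factorial : ℝ)⁻¹ * iteratedDerivWithin i f s a) * (Polynomial.X - Polynomial.C a) ^ i, ?_, fun x => ?_⟩
  · refine Polynomial.natDegree_sum_le_of_forall_le _ _ fun i hi => ?_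
    refine (Polynomial.natDegree_C_mul_le _ _).trans ?_
    rw [Polynomial.natDegree_pow, Polynomial.natDegree_X_sub_C, mul_one]
    exact Nat.le_of_lt_succ (Finset.mem_range.1 hi)
  · rw [taylor_within_apply, Polynomial.eval_finsetSum]
    refine Finset.sum_congr rfl fun i _ => ?_
    simp only [Polynomial.eval_mul, Polynomial.eval_C, Polynomial.eval_pow, Polynomial.eval_sub,
      Polynomial.eval_X, smul_eq_mul]
    ring

/-- Approximation property of the right Radau projection: for every
k ≥ 1 there is C > 0, depending only on k, such that on any cell [α, β] of length
h = β - α, for any (k+1)-times continuously differentiable g with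
|g^(k+1)| ≤ M on [α, β], the right Radau projection p = P⁻g satisfies
‖p - g‖_{L²} ≤ C M h^{k+3/2} and ‖p - g‖_∞ ≤ C M h^{k+1}. -/
theorem radau_projection_approximation (k : ℕ) (hk : 1 ≤ k) :
    ∃ C : ℝ, 0 < C ∧ ∀ α β : ℝ, α < β → ∀ g : ℝ → ℝ, ∀ M : ℝ,
      ContDiffOn ℝ (k + 1) g (Set.Icc α β) →
      (∀ x ∈ Set.Icc α β, |iteratedDerivWithin (k + 1) g (Set.Icc α β) x| ≤ M) →
      ∀ p : Polynomial ℝ, p.natDegree ≤ k →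
        (∀ q : Polynomial ℝ, q.natDegree ≤ k - 1 →
          ∫ x in α..β, (p.eval x - g x) * q.eval x = 0) →
        p.eval β = g β →
        Real.sqrt (∫ x in α..β, (p.eval x - g x) ^ 2) ≤
            C * M * (β - α) ^ ((k : ℝ) + 3 / 2) ∧
          ∀ x ∈ Set.Icc α β, |p.eval x - g x| ≤ C * M * (β - α) ^ (k + 1) := by
  obtain ⟨C, hC, hstab⟩ := exists_radau_projection_stability k
  refine ⟨C, hC, fun α β hαβ g M hg hM p hp horth hpβ => ?_⟩
  have hpos : 0 < β - α := sub_pos.2 hαβ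
  have hM0 : 0 ≤ M := (abs_nonneg _).trans (hM α ⟨le_rfl, hαβ.le⟩)
  obtain ⟨T, hT, hTeval⟩ := exists_polynomial_eval_eq_taylorWithinEval g k (Set.Icc α β) α
  have hrem (x : ℝ) (hx : x ∈ Set.Icc α β) : |g x - T.eval x| ≤ M * (β - α) ^ (k + 1) := by
    rw [hTeval]
    refine (taylor_mean_remainder_bound hαβ.le hg hx hM).trans ?_
    have h1 : (x - α) ^ (k + 1) ≤ (β - α) ^ (k + 1) :=
      pow_le_pow_left₀ (sub_nonneg.2 hx.1) (by linarith [hx.2]) _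
    refine (div_le_self (mul_nonneg hM0 (pow_nonneg (sub_nonneg.2 hx.1) _)) ?_).trans
      (mul_le_mul_of_nonneg_left h1 hM0)
    exact_mod_cast Nat.one_le_iff_ne_zero.2 k.factorial_ne_zero
  have hsub (x : ℝ) : (p - T).eval x - (g x - T.eval x) = p.eval x - g x := by
    rw [Polynomial.eval_sub]
    ring
  have hsup (x : ℝ) (hx : x ∈ Set.Icc α β) :
      |p.eval x - g x| ≤ C * M * (β - α) ^ (k + 1) := by
    have := hstab α β hαβ (fun x => g x - T.eval x) (M * (β - α) ^ (k + 1))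
      (hg.continuousOn.sub T.continuousOn) hrem (p - T)
      ((Polynomial.natDegree_sub_le _ _).trans (max_le hp hT))
      (by simpa only [hsub] using horth) (by rw [Polynomial.eval_sub, hpβ]) x hx
    rwa [hsub, ← mul_assoc] at this
  refine ⟨?_, hsup⟩
  have hB : 0 ≤ C * M * (β - α) ^ (k + 1) := by positivity
  have hint : ∫ x in α..β, (p.eval x - g x) ^ 2 ≤
      (C * M * (β - α) ^ (k + 1)) ^ 2 * (β - α) := by
    have := intervalIntegral.norm_integral_le_of_norm_le_const (a := α) (b := β)
      (f := fun x => (p.eval x - g x) ^ 2) (C := (C * M * (β - α) ^ (k + 1)) ^ 2) fun x hx => by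
        rw [Set.uIoc_of_le hαβ.le] at hx
        rw [norm_pow, Real.norm_eq_abs]
        exact pow_le_pow_left₀ (abs_nonneg _) (hsup x ⟨hx.1.le, hx.2⟩) 2
    rw [abs_of_pos hpos] at this
    exact (le_abs_self _).trans this
  have hpow : (β - α) ^ ((k : ℝ) + 3 / 2) = (β - α) ^ (k + 1) * √(β - α) := by
    rw [Real.sqrt_eq_rpow, ← Real.rpow_natCast, ← Real.rpow_add hpos]
    congr 1
    push_cast
    ring
  calc √(∫ x in α..β, (p.eval x - g x) ^ 2)
      ≤ √((C * M * (β - α) ^ (k + 1)) ^ 2 * (β - α)) := Real.sqrt_le_sqrt hint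
    _ = C * M * (β - α) ^ ((k : ℝ) + 3 / 2) := by
        rw [Real.sqrt_mul (sq_nonneg _), Real.sqrt_sq hB, hpow, mul_assoc]
end
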